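/- If G is an (n,d,λ)-graph (a d-regular graph on n vertices all of whose adjacency eigenvalues other than the largest have absolute value at most λ), then the vertex integrity satisfies ι(G) ≥ ((d - λ)/(d + λ)) · n. -/

import Mathlib

open SimpleGraph

/-- The maximum size of a connected component of a graph. -/
noncomputable def maxCompCard {W : Type*} (H : SimpleGraph W) : ℕ :=
  sSup {m | ∃ c : H.ConnectedComponent, m = c.supp.ncard}

/-- The vertex integrity of a graph. -/
noncomputable def integrity {V : Type*} [Fintype V] (G : SimpleGraph V) : ℕ :=
  sInf {m | ∃ S : Finset V, m = S.card + maxCompCard (G.induce ((↑S : Set V)ᶜ))}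

lemma aux_balance {ι : Type*} [DecidableEq ι] (w : ι → ℤ) (k : ℤ) (I : Finset ι)
    (h0 : ∀ i, 0 ≤ w i) (hk : ∀ i, w i ≤ k) (hk0 : 0 ≤ k) :
    ∃ J ⊆ I, |∑ i ∈ J, w i - ∑ i ∈ I \ J, w i| ≤ k := by
  induction I using Finset.induction_on with
  | empty => exact ⟨∅, by simp, by simpa using hk0⟩
  | insert c I hc ih =>
    obtain ⟨J, hJ, h⟩ := ih
    have hcJ : c ∉ J := fun h => hc (hJ h)
    have h1 := h0 c
    have h2 := hk c
    rw [abs_le] at h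
    by_cases hs : 0 ≤ ∑ i ∈ J, w i - ∑ i ∈ I \ J, w i
    · refine ⟨J, hJ.trans (Finset.subset_insert _ _), ?_⟩
      rw [Finset.insert_sdiff_of_notMem _ hcJ, Finset.sum_insert (by simp [hc]), abs_le]
      constructor <;> linarith [h.1, h.2]
    · refine ⟨insert c J, Finset.insert_subset_insert _ hJ, ?_⟩
      have : insert c I \ insert c J = I \ J := by
        ext x; simp only [Finset.mem_sdiff, Finset.mem_insert]
        constructor
        · tauto
        · rintro ⟨a, b⟩
          refine ⟨Or.inr a, ?_⟩
          rintro (rfl | h)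
          · exact hc a
          · exact b h
      rw [this, Finset.sum_insert hcJ, abs_le]
      push Not at hs
      constructor <;> linarith [h.1, h.2]

lemma aux_parseval {V : Type*} [Fintype V] [DecidableEq V]
    (b : OrthonormalBasis V ℝ (EuclideanSpace ℝ V)) (f g : V → ℝ) :
    ∑ i, ((b i : V → ℝ) ⬝ᵥ f) * ((b i : V → ℝ) ⬝ᵥ g) = f ⬝ᵥ g := by
  have := b.sum_inner_mul_inner (WithLp.toLp 2 f) (WithLp.toLp 2 g)
  simp only [EuclideanSpace.inner_eq_star_dotProduct, star_trivial] at this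
  rw [dotProduct_comm f g, ← this]
  refine Finset.sum_congr rfl fun i _ => ?_
  rw [dotProduct_comm g]

lemma aux_spec {V : Type*} [Fintype V] [DecidableEq V] (G : SimpleGraph V)
    [DecidableRel G.Adj] (d : ℕ) (lam : ℝ)
    (hreg : G.IsRegularOfDegree d)
    (hA : (G.adjMatrix ℝ).IsHermitian)
    (i₀ : V) (hlam : ∀ i : V, i ≠ i₀ → |hA.eigenvalues i| ≤ lam) (hd : lam < d)
    (g : V → ℝ) (hg : (fun _ => (1:ℝ)) ⬝ᵥ g = 0) :
    (G.adjMatrix ℝ).mulVec g ⬝ᵥ (G.adjMatrix ℝ).mulVec g ≤ lam ^ 2 * (g ⬝ᵥ g) := by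
  set M := G.adjMatrix ℝ with hM
  set u : V → V → ℝ := fun i => (hA.eigenvectorBasis i : V → ℝ) with hu
  have hP : ∀ f g : V → ℝ, ∑ i, (u i ⬝ᵥ f) * (u i ⬝ᵥ g) = f ⬝ᵥ g :=
    aux_parseval hA.eigenvectorBasis
  have hE : ∀ i (g : V → ℝ), u i ⬝ᵥ M.mulVec g = hA.eigenvalues i * (u i ⬝ᵥ g) := by
    intro i g
    have h1 : M.mulVec (u i) = hA.eigenvalues i • u i := hA.mulVec_eigenvectorBasis i
    have h2 : M.transpose = M := by simp [hM]
    rw [Matrix.dotProduct_mulVec, ← Matrix.mulVec_transpose, h2, h1, smul_dotProduct, smul_eq_mul]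
  set o : V → ℝ := fun _ => (1:ℝ) with ho
  have hMo : M.mulVec o = (d:ℝ) • o := by
    ext v
    simp [hM, ho, SimpleGraph.adjMatrix_mulVec_apply, hreg.degree_eq v]
  have h0 : ∀ i, i ≠ i₀ → u i ⬝ᵥ o = 0 := by
    intro i hi
    have := hE i o
    rw [hMo, dotProduct_smul, smul_eq_mul] at this
    have h3 : ((d:ℝ) - hA.eigenvalues i) * (u i ⬝ᵥ o) = 0 := by linarith
    rcases mul_eq_zero.1 h3 with h | h
    · have := (abs_le.1 (hlam i hi)).2
      linarith
    · exact h
  have hoo : o ⬝ᵥ o ≠ 0 := by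
    have : Nonempty V := ⟨i₀⟩
    simp [ho, dotProduct]
  have hoi : u i₀ ⬝ᵥ o ≠ 0 := by
    intro h
    apply hoo
    rw [← hP]
    refine Finset.sum_eq_zero fun i _ => ?_
    by_cases hi : i = i₀
    · rw [hi, h, zero_mul]
    · rw [h0 i hi, zero_mul]
  have hg0 : u i₀ ⬝ᵥ g = 0 := by
    have := hP o g
    rw [hg, Finset.sum_eq_single i₀ (fun i _ hi => by rw [h0 i hi, zero_mul]) (by simp)] at this
    exact (mul_eq_zero.1 this).resolve_left hoi
  rw [← hP, ← hP g g, Finset.mul_sum]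
  refine Finset.sum_le_sum fun i _ => ?_
  rw [hE]
  by_cases hi : i = i₀
  · rw [hi, hg0]; simp
  · have h1 : hA.eigenvalues i ^ 2 ≤ lam ^ 2 := by
      rw [← sq_abs]
      exact pow_le_pow_left₀ (abs_nonneg _) (hlam i hi) 2
    nlinarith [mul_le_mul_of_nonneg_right h1 (sq_nonneg (u i ⬝ᵥ g))]

lemma aux_eml {V : Type*} [Fintype V] [DecidableEq V] (G : SimpleGraph V)
    [DecidableRel G.Adj] (d : ℕ) (lam : ℝ)
    (hreg : G.IsRegularOfDegree d)
    (hA : (G.adjMatrix ℝ).IsHermitian)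
    (i₀ : V) (hlam : ∀ i : V, i ≠ i₀ → |hA.eigenvalues i| ≤ lam) (hd : lam < d)
    (A B : Finset V) (hAB : ∀ x ∈ A, ∀ y ∈ B, ¬ G.Adj x y) :
    ((d:ℝ) * A.card * B.card) ^ 2 ≤
      lam ^ 2 * (A.card * (Fintype.card V - A.card)) * (B.card * (Fintype.card V - B.card)) := by
  set n : ℝ := (Fintype.card V : ℝ) with hn
  have hnpos : 0 < n := by
    have : Nonempty V := ⟨i₀⟩
    simp [hn, Fintype.card_pos]
  set M := G.adjMatrix ℝ with hM
  set o : V → ℝ := fun _ => (1:ℝ) with ho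
  let ind : Finset V → V → ℝ := fun A v => if v ∈ A then 1 else 0
  let z : Finset V → V → ℝ := fun A => n • ind A - (A.card : ℝ) • o
  have hMo : M.mulVec o = (d:ℝ) • o := by
    ext v
    simp [hM, ho, SimpleGraph.adjMatrix_mulVec_apply, hreg.degree_eq v]
  have hoo : o ⬝ᵥ o = n := by simp [ho, dotProduct, hn]
  have hio : ∀ A, ind A ⬝ᵥ o = A.card := by intro A; simp [ind, ho, dotProduct]
  have hoi : ∀ A, o ⬝ᵥ ind A = A.card := by intro A; rw [dotProduct_comm, hio]
  have hii : ∀ A, ind A ⬝ᵥ ind A = A.card := by intro A; simp [ind, dotProduct]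
  have hoz : ∀ A, o ⬝ᵥ z A = 0 := by
    intro A
    simp only [z, dotProduct_sub, dotProduct_smul, hoi, hoo, smul_eq_mul]; ring
  have hzz : ∀ A, z A ⬝ᵥ z A = n * (A.card * (n - A.card)) := by
    intro A
    simp only [z, dotProduct_sub, sub_dotProduct, smul_dotProduct, dotProduct_smul, hoi, hoo, hio, hii, smul_eq_mul]; ring
  have hT : M.transpose = M := by simp [hM]
  have hoM : o ⬝ᵥ M.mulVec (ind B) = d * B.card := by
    rw [Matrix.dotProduct_mulVec, ← Matrix.mulVec_transpose, hT, hMo, smul_dotProduct, hoi, smul_eq_mul]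
  have hAM : ind A ⬝ᵥ M.mulVec (ind B) = 0 := by
    unfold dotProduct
    refine Finset.sum_eq_zero fun x _ => ?_
    by_cases hx : x ∈ A
    · have : M.mulVec (ind B) x = 0 := by
        rw [hM, SimpleGraph.adjMatrix_mulVec_apply]
        refine Finset.sum_eq_zero fun y hy => ?_
        have : y ∉ B := fun h => hAB x hx y h (by simpa using hy)
        simp [ind, this]
      rw [this, mul_zero]
    · simp [ind, hx]
  have hzM : z A ⬝ᵥ M.mulVec (z B) = - n * (d * A.card * B.card) := by
    simp only [z, Matrix.mulVec_sub, Matrix.mulVec_smul, hMo, dotProduct_sub, sub_dotProduct, smul_dotProduct, dotProduct_smul, hoi, hoo, hio, hii, hAM, hoM, smul_eq_mul]; ring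
  have hCS : (z A ⬝ᵥ M.mulVec (z B)) ^ 2 ≤ (z A ⬝ᵥ z A) * (M.mulVec (z B) ⬝ᵥ M.mulVec (z B)) := by
    have := Finset.sum_mul_sq_le_sq_mul_sq Finset.univ (z A) (M.mulVec (z B))
    simpa only [dotProduct, sq] using this
  have hS := aux_spec G d lam hreg hA i₀ hlam hd (z B) (hoz B)
  have hzA : 0 ≤ z A ⬝ᵥ z A := by
    unfold dotProduct
    exact Finset.sum_nonneg fun i _ => mul_self_nonneg _
  have h := hCS.trans (mul_le_mul_of_nonneg_left hS hzA)
  rw [hzM, hzz, hzz] at h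
  have hn2 : 0 < n ^ 2 := by positivity
  refine le_of_mul_le_mul_left ?_ hn2
  linarith

lemma aux_arith (d lam n a b : ℝ) (hl : 0 ≤ lam) (hd : lam < d) (hb : 0 ≤ b) (hab : b ≤ a)
    (han : a ≤ n)
    (h : (d * a * b) ^ 2 ≤ lam ^ 2 * (a * (n - a)) * (b * (n - b))) :
    b * (d + lam) ≤ lam * n := by
  rcases hb.eq_or_lt with rfl | hb
  · simp; nlinarith
  have ha : 0 < a := by linarith
  have hpos : 0 < a * b := by positivity
  have h1 : d ^ 2 * (a * b) ≤ lam ^ 2 * ((n - a) * (n - b)) := by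
    refine le_of_mul_le_mul_left ?_ hpos
    nlinarith
  have h2 : (n - a) * (n - b) ≤ (n - b) * (n - b) :=
    mul_le_mul_of_nonneg_right (by linarith) (by linarith)
  have h3 : b * b ≤ a * b := mul_le_mul_of_nonneg_right hab hb.le
  have h4 : (d * b) ^ 2 ≤ (lam * (n - b)) ^ 2 := by
    have e1 := mul_le_mul_of_nonneg_left h2 (sq_nonneg lam)
    have e2 := mul_le_mul_of_nonneg_left h3 (sq_nonneg d)
    nlinarith
  have := abs_le_of_sq_le_sq h4 (mul_nonneg hl (by linarith))
  linarith [le_abs_self (d * b)]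

lemma aux_split {V : Type*} [Fintype V] [DecidableEq V] (G : SimpleGraph V) (S : Finset V) :
    ∃ A B : Finset V, (∀ x ∈ A, ∀ y ∈ B, ¬ G.Adj x y) ∧ A.card + B.card + S.card = Fintype.card V ∧
      |(A.card : ℤ) - B.card| ≤ maxCompCard (G.induce ((↑S : Set V)ᶜ)) := by
  classical
  set H := G.induce ((↑S : Set V)ᶜ) with hH
  let w : H.ConnectedComponent → ℤ := fun c => c.supp.ncard
  have hk : ∀ c, w c ≤ maxCompCard H := by
    intro c
    have : c.supp.ncard ≤ maxCompCard H := by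
      refine le_csSup ?_ ⟨c, rfl⟩
      refine Set.Finite.bddAbove ?_
      have : {m | ∃ c : H.ConnectedComponent, m = c.supp.ncard} =
        Set.range (fun c : H.ConnectedComponent => c.supp.ncard) := by
        ext m; simp [eq_comm]
      rw [this]
      exact Set.finite_range _
    exact Int.ofNat_le.2 this
  have : Fintype H.ConnectedComponent := Fintype.ofFinite _
  obtain ⟨J, -, hJ⟩ := aux_balance w (maxCompCard H) Finset.univ
    (fun i => by simp [w]) hk (by simp)
  let P : Finset H.ConnectedComponent → Finset ↥((↑S : Set V)ᶜ) :=
    fun J => Finset.univ.filter (fun x => H.connectedComponentMk x ∈ J)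
  let A : Finset H.ConnectedComponent → Finset V := fun J => (P J).map (Function.Embedding.subtype _)
  have hc : ∀ J, ((A J).card : ℤ) = ∑ c ∈ J, w c := by
    intro J
    have : (A J).card = ∑ c ∈ J, c.supp.ncard := by
      rw [Finset.card_map, Finset.card_eq_sum_card_fiberwise (f := H.connectedComponentMk) (t := J)]
      · refine Finset.sum_congr rfl fun c hc => ?_
        rw [← Set.ncard_coe_finset]
        congr 1
        ext x
        simp only [P, Finset.coe_filter, Finset.mem_filter, Finset.mem_univ, true_and,
          Set.mem_ofPred_eq, SimpleGraph.ConnectedComponent.mem_supp_iff]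
        constructor
        · exact fun h => h.2
        · intro h; exact ⟨h ▸ hc, h⟩
      · intro x hx
        simpa [P] using hx
    simp [this, w]
  refine ⟨A J, A (Finset.univ \ J), ?_, ?_, ?_⟩
  · intro x hx y hy hxy
    simp only [A, P, Finset.mem_map, Finset.mem_filter, Finset.mem_univ, true_and,
      Finset.mem_sdiff] at hx hy
    obtain ⟨x', hx', rfl⟩ := hx
    obtain ⟨y', hy', rfl⟩ := hy
    have hadj : H.Adj x' y' := hxy
    apply hy'
    rw [← SimpleGraph.ConnectedComponent.connectedComponentMk_eq_of_adj hadj]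
    exact hx'
  · have h1 : (A J).card + (A (Finset.univ \ J)).card = Fintype.card ↥((↑S : Set V)ᶜ) := by
      have := Finset.card_filter_add_card_filter_not (s := (Finset.univ : Finset ↥((↑S : Set V)ᶜ)))
        (fun x => H.connectedComponentMk x ∈ J)
      rw [Finset.card_univ] at this
      rw [← this, Finset.card_map, Finset.card_map]
      simp [P]
    rw [h1, ← Nat.card_eq_fintype_card, Nat.card_coe_set_eq, ← Set.ncard_coe_finset S,
      ← Nat.card_eq_fintype_card, add_comm]
    exact Set.ncard_add_ncard_compl _
  · rw [hc, hc]
    exact hJ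


open SimpleGraph

/-- If `G` is an `(n, d, λ)`-graph, i.e. a `d`-regular graph on `n` vertices all of
whose adjacency eigenvalues other than the largest one (which equals `d`) have
absolute value at most `λ`, then `ι(G) ≥ ((d - λ)/(d + λ)) n`. -/
theorem stmt1 {V : Type*} [Fintype V] [DecidableEq V] (G : SimpleGraph V)
    [DecidableRel G.Adj] (d : ℕ) (lam : ℝ)
    (hreg : G.IsRegularOfDegree d)
    (hA : (G.adjMatrix ℝ).IsHermitian)
    (i₀ : V) (hi₀ : hA.eigenvalues i₀ = d)
    (hlam : ∀ i : V, i ≠ i₀ → |hA.eigenvalues i| ≤ lam) :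
    ((d : ℝ) - lam) / ((d : ℝ) + lam) * (Fintype.card V : ℝ) ≤ (integrity G : ℝ) := by
  have hmem : integrity G ∈ {m | ∃ S : Finset V, m = S.card + maxCompCard (G.induce ((↑S : Set V)ᶜ))} :=
    Nat.sInf_mem ⟨_, ∅, rfl⟩
  obtain ⟨S, hS⟩ := hmem
  have hn0 : (0:ℝ) ≤ Fintype.card V := Nat.cast_nonneg _
  have hI0 : (0:ℝ) ≤ integrity G := Nat.cast_nonneg _
  have hd0 : (0:ℝ) ≤ d := Nat.cast_nonneg _
  by_cases hex : ∃ i, i ≠ i₀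
  · obtain ⟨i, hi⟩ := hex
    have hl : 0 ≤ lam := (abs_nonneg _).trans (hlam i hi)
    by_cases hd : lam < d
    · obtain ⟨A, B, hAB, hcard, hbal⟩ := aux_split G S
      have hcard' : (A.card : ℝ) + B.card + S.card = Fintype.card V := by exact_mod_cast hcard
      have hbal' : |(A.card : ℝ) - B.card| ≤ maxCompCard (G.induce ((↑S : Set V)ᶜ)) := by
        exact_mod_cast hbal
      have hS' : (integrity G : ℝ) = S.card + maxCompCard (G.induce ((↑S : Set V)ᶜ)) := by
        exact_mod_cast hS
      have hE := aux_eml G d lam hreg hA i₀ hlam hd A B hAB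
      have hA0 : (0:ℝ) ≤ A.card := Nat.cast_nonneg _
      have hB0 : (0:ℝ) ≤ B.card := Nat.cast_nonneg _
      have hS0 : (0:ℝ) ≤ S.card := Nat.cast_nonneg _
      have hpos : (0:ℝ) < d + lam := by linarith
      rw [abs_le] at hbal'
      rw [div_mul_eq_mul_div, div_le_iff₀ hpos]
      rcases le_total (B.card : ℝ) A.card with h | h
      · have := aux_arith d lam _ _ _ hl hd hB0 h (by linarith) hE
        have h2 : (Fintype.card V : ℝ) - 2 * B.card ≤ integrity G := by linarith [hbal'.2]
        nlinarith [mul_le_mul_of_nonneg_right h2 hpos.le]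
      · have := aux_arith d lam (Fintype.card V) B.card A.card hl hd hA0 h (by linarith) (by linarith)
        have h2 : (Fintype.card V : ℝ) - 2 * A.card ≤ integrity G := by linarith [hbal'.1]
        nlinarith [mul_le_mul_of_nonneg_right h2 hpos.le]
    · push Not at hd
      refine le_trans ?_ hI0
      exact mul_nonpos_of_nonpos_of_nonneg
        (div_nonpos_of_nonpos_of_nonneg (by linarith) (by linarith)) hn0
  · push Not at hex
    have hd : d = 0 := by
      rw [← hreg.degree_eq i₀, SimpleGraph.degree, Finset.card_eq_zero, Finset.eq_empty_iff_forall_notMem]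
      intro x hx
      rw [hex x] at hx
      simp at hx
    refine le_trans ?_ hI0
    refine mul_nonpos_of_nonpos_of_nonneg ?_ hn0
    rw [hd]
    simp only [Nat.cast_zero, zero_sub, zero_add, neg_div]
    have := div_self_le_one lam
    by_cases h : lam = 0
    · simp [h]
    · rw [div_self h]; norm_num
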